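/- arXiv:2007.10881 — 2 statements merged into one kernel-verified Lean document; each statement's English description precedes it below -/
import Mathlib

section
/- For all integers k ≥ 1, m ≥ 0, n ≥ 0, and for i = 1 or i = 2, p^{2k+1}_{2,i}(m,n) = b^{2k+1}_{2,i}(m,n); that is, the number of partitions of n with exactly m parts, all parts at least 2k+1, at most i-1 parts equal to 2k+1, every even part at least 2(m+k), and odd parts (in decreasing order) satisfying λ_{j_ℓ} - λ_{j_{ℓ+2}} ≥ 4, equals the number of partitions of n with exactly m parts, all parts at least 2k+1, at most i-1 parts equal to 2k+1, and any two parts differing by at least 2. -/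
/-!
Formalization of statements from "Even-Odd partition identities of
Rogers-Ramanujan type" (P. Afsharijoo).

A partition of `n` is modelled by Mathlib's `Nat.Partition n` (a multiset of
positive parts summing to `n`).  Sorted-in-increasing-order lists of parts are
used to express the conditions on consecutive parts of the decreasing
enumeration `λ_1 ≥ λ_2 ≥ …`.
-/

/-- The parts of a partition, sorted in increasing order. -/
def Nat.Partition.sortedParts {n : ℕ} (p : n.Partition) : List ℕ :=
  p.parts.sort (· ≤ ·)

/-- The odd parts of a partition, sorted in increasing order. -/
def Nat.Partition.oddParts {n : ℕ} (p : n.Partition) : List ℕ :=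
  (p.parts.filter (fun x => ¬ Even x)).sort (· ≤ ·)

/-- The even parts of a partition, sorted in increasing order. -/
def Nat.Partition.evenParts {n : ℕ} (p : n.Partition) : List ℕ :=
  (p.parts.filter (fun x => Even x)).sort (· ≤ ·)

/-- `GapCond L d g` : any two entries of `L` lying `d` positions apart differ by at
least `g`.  When `L` lists parts in increasing order, this says that the
corresponding decreasing enumeration `λ_1 ≥ λ_2 ≥ …` satisfies
`λ_ℓ - λ_{ℓ+d} ≥ g` for every valid index `ℓ`.
In particular `GapCond p.sortedParts 1 2` says that any two parts of `p`
differ by at least `2` (no equal and no consecutive parts), and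
`GapCond p.oddParts 2 4` says that the odd parts satisfy
`λ_{j_ℓ} - λ_{j_{ℓ+2}} ≥ 4`. -/
def GapCond (L : List ℕ) (d g : ℕ) : Prop :=
  ∀ ℓ : ℕ, ℓ + d < L.length → g ≤ L[ℓ + d]! - L[ℓ]!

/-- `p2k1 k i m n` = number of partitions of `n` with exactly `m` parts, all parts
at least `2k+1`, at most `i - 1` parts equal to `2k+1`, every even part at least
`2(m+k)`, and odd parts (in decreasing order) satisfying
`λ_{j_ℓ} - λ_{j_{ℓ+2}} ≥ 4`. -/
noncomputable def p2k1 (k i m n : ℕ) : ℕ :=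
  Nat.card {p : n.Partition //
    Multiset.card p.parts = m ∧
    (∀ x ∈ p.parts, 2 * k + 1 ≤ x) ∧
    Multiset.count (2 * k + 1) p.parts ≤ i - 1 ∧
    (∀ x ∈ p.parts, Even x → 2 * (m + k) ≤ x) ∧
    GapCond p.oddParts 2 4}

/-- `b2k1 k i m n` = number of partitions of `n` with exactly `m` parts, all parts
at least `2k+1`, at most `i - 1` parts equal to `2k+1`, and any two parts
differing by at least `2`. -/
noncomputable def b2k1 (k i m n : ℕ) : ℕ :=
  Nat.card {p : n.Partition //
    Multiset.card p.parts = m ∧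
    (∀ x ∈ p.parts, 2 * k + 1 ≤ x) ∧
    Multiset.count (2 * k + 1) p.parts ≤ i - 1 ∧
    GapCond p.sortedParts 1 2}

/-! ### Gap conditions in terms of multiplicities -/

lemma List.Pairwise.countP_lt_le_iff {L : List ℕ} (hL : L.Pairwise (· ≤ ·)) (c e : ℕ) :
    L.countP (· < c) ≤ e ↔ (e < L.length → c ≤ L[e]!) := by
  induction L generalizing e with
  | nil => simp
  | cons a L ih =>
    rw [List.pairwise_cons] at hL
    obtain ⟨ha, hL⟩ := hL
    have ih := ih hL
    by_cases hac : a < c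
    · cases e with
      | zero => simp [hac]
      | succ e => simpa [hac] using ih e
    · have h0 : L.countP (· < c) = 0 := by
        rw [List.countP_eq_zero]
        intro x hx
        have := ha x hx
        simp only [decide_eq_true_eq]
        omega
      have h1 : (a :: L).countP (· < c) = 0 := by simp [hac, h0]
      simp only [h1, Nat.zero_le, true_iff]
      intro he
      cases e with
      | zero => simpa using hac
      | succ e => simpa using (ih e).1 (by omega) (by simpa using he)

lemma gapCond_cons (a : ℕ) (L : List ℕ) (d g : ℕ) :
    GapCond (a :: L) (d + 1) g ↔ (d < L.length → g ≤ L[d]! - a) ∧ GapCond L (d + 1) g := by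
  constructor
  · intro h
    refine ⟨fun hd => by simpa using h 0 (by simpa using hd), fun l hl => ?_⟩
    have := h (l + 1) (by simp only [List.length_cons]; omega)
    rw [show l + 1 + (d + 1) = l + (d + 1) + 1 by omega] at this
    simpa using this
  · rintro ⟨h0, h⟩ l hl
    cases l with
    | zero => simpa using h0 (by simpa using hl)
    | succ l =>
      have := h l (by simp only [List.length_cons] at hl; omega)
      rw [show l + 1 + (d + 1) = l + (d + 1) + 1 by omega]
      simpa using this

/-- In a sorted list, entries `d` apart differ by at least `g` iff every window of length `g`
contains at most `d` entries. -/
lemma gapCond_iff_countP {L : List ℕ} (hL : L.Pairwise (· ≤ ·)) (d g : ℕ) (hg : 0 < g) :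
    GapCond L (d + 1) g ↔ ∀ x, L.countP (fun y => x ≤ y ∧ y < x + g) ≤ d + 1 := by
  induction L with
  | nil => simp [GapCond]
  | cons a L ih =>
    rw [List.pairwise_cons] at hL
    obtain ⟨ha, hL⟩ := hL
    have key : (d < L.length → g ≤ L[d]! - a) ↔ L.countP (· < a + g) ≤ d := by
      rw [List.Pairwise.countP_lt_le_iff hL]
      refine imp_congr_right fun _ => ?_
      omega
    have window : L.countP (fun y => a ≤ y ∧ y < a + g) = L.countP (· < a + g) :=
      List.countP_congr fun y hy => by simpa using fun _ => ha y hy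
    rw [gapCond_cons, ih hL, key]
    constructor
    · rintro ⟨h0, h⟩ x
      by_cases hx : x ≤ a
      · calc
          _ ≤ (a :: L).countP (fun y => a ≤ y ∧ y < a + g) := by
            refine List.countP_mono_left fun y hy => ?_
            have : a ≤ y := by
              rcases List.mem_cons.1 hy with rfl | hy
              · exact le_rfl
              · exact ha y hy
            simp only [decide_eq_true_eq]
            omega
          _ ≤ d + 1 := by
            rw [List.countP_cons, window]
            split <;> omega
      · rw [List.countP_cons_of_neg (by simp [hx])]
        exact h x
    · intro h
      refine ⟨?_, fun x => ?_⟩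
      · have := h a
        rw [List.countP_cons_of_pos (by simpa using hg), window] at this
        omega
      · exact ((List.sublist_cons_self a L).countP_le).trans (h x)

lemma Multiset.countP_eq_count_add_count {s : Multiset ℕ} {p : ℕ → Prop} [DecidablePred p]
    {a b : ℕ} (hab : a ≠ b) (hp : ∀ y, p y ↔ y = a ∨ y = b) :
    s.countP p = s.count a + s.count b := by
  induction s using Multiset.induction_on with
  | empty => simp
  | cons c s ih =>
    rw [Multiset.countP_cons, Multiset.count_cons, Multiset.count_cons, ih]
    have := hp c
    grind

lemma gapCond_sort_iff (s : Multiset ℕ) (d g : ℕ) (hg : 0 < g) :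
    GapCond (s.sort (· ≤ ·)) (d + 1) g ↔ ∀ x, s.countP (fun y => x ≤ y ∧ y < x + g) ≤ d + 1 := by
  rw [gapCond_iff_countP (s.pairwise_sort _) d g hg]
  simp only [← Multiset.coe_countP, Multiset.sort_eq]

lemma gapCond_sortedParts_iff {n : ℕ} (p : n.Partition) :
    GapCond p.sortedParts 1 2 ↔ ∀ x, p.parts.count x + p.parts.count (x + 1) ≤ 1 := by
  rw [Nat.Partition.sortedParts, gapCond_sort_iff _ 0 2 (by norm_num)]
  refine forall_congr' fun x => ?_
  rw [Multiset.countP_eq_count_add_count (a := x) (b := x + 1) (by omega) (by omega)]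

lemma gapCond_oddParts_iff {n : ℕ} (p : n.Partition) :
    GapCond p.oddParts 2 4 ↔
      ∀ x, Odd x → p.parts.count x + p.parts.count (x + 2) ≤ 2 := by
  rw [Nat.Partition.oddParts, gapCond_sort_iff _ 1 4 (by norm_num)]
  simp only [Multiset.countP_filter]
  have odd_window (x : ℕ) (hx : Odd x) :
      p.parts.countP (fun y => (x ≤ y ∧ y < x + 4) ∧ ¬ Even y) =
        p.parts.count x + p.parts.count (x + 2) :=
    Multiset.countP_eq_count_add_count (by omega) (by grind)
  constructor
  · intro h x hx
    rw [← odd_window x hx]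
    exact h x
  · intro h x
    rcases Nat.even_or_odd x with hx | hx
    · rw [Multiset.countP_eq_count_add_count (a := x + 1) (b := x + 3) (by omega) (by grind)]
      exact h (x + 1) hx.add_one
    · rw [odd_window x hx]
      exact h x hx

/-! ### Counting multisets by sum -/

/-- The number of multisets with property `P` and sum `n`. The sum ranges over `ℤ` so that
recurrences need no side conditions. -/
noncomputable def countSum (P : Multiset ℕ → Prop) (n : ℤ) : ℕ :=
  Set.ncard {s : Multiset ℕ | P s ∧ (s.sum : ℤ) = n}

lemma countSum_congr {P Q : Multiset ℕ → Prop} (h : ∀ s, P s ↔ Q s) (n : ℤ) :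
    countSum P n = countSum Q n := by
  simp only [countSum, h]

lemma countSum_of_neg (P : Multiset ℕ → Prop) {n : ℤ} (hn : n < 0) : countSum P n = 0 := by
  have : {s : Multiset ℕ | P s ∧ (s.sum : ℤ) = n} = ∅ := by
    ext s
    simp only [Set.mem_ofPred_eq, Set.mem_empty_iff_false, iff_false, not_and]
    omega
  rw [countSum, this, Set.ncard_empty]

lemma finite_multiset_card_sum (m : ℕ) (n : ℤ) :
    {s : Multiset ℕ | s.card = m ∧ (s.sum : ℤ) = n}.Finite := by
  refine (Set.finite_Iic (m • (Multiset.range (n.toNat + 1)))).subset ?_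
  rintro s ⟨hc, hs⟩
  rw [Set.mem_Iic, Multiset.le_iff_count]
  intro a
  by_cases ha : a ∈ s
  · have h1 : a ≤ s.sum := Multiset.single_le_sum (fun _ _ => Nat.zero_le _) a ha
    have h2 : 1 ≤ (Multiset.range (n.toNat + 1)).count a :=
      Multiset.one_le_count_iff_mem.2 (Multiset.mem_range.2 (by omega))
    rw [Multiset.count_nsmul]
    calc s.count a ≤ s.card := Multiset.count_le_card a s
      _ = m * 1 := by rw [hc, mul_one]
      _ ≤ _ := Nat.mul_le_mul_left m h2
  · rw [Multiset.count_eq_zero_of_notMem ha]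
    exact Nat.zero_le _

lemma countSum_add {P Q R : Multiset ℕ → Prop} {m : ℕ} (hm : ∀ s, P s → s.card = m)
    (hP : ∀ s, P s ↔ Q s ∨ R s) (hQR : ∀ s, Q s → ¬ R s) (n : ℤ) :
    countSum P n = countSum Q n + countSum R n := by
  rw [countSum, countSum, countSum, ← Set.ncard_union_eq
    (Set.disjoint_left.2 fun s hs hs' => hQR s hs.1 hs'.1)
    ((finite_multiset_card_sum m n).subset fun s hs => ⟨hm s ((hP s).2 (.inl hs.1)), hs.2⟩)
    ((finite_multiset_card_sum m n).subset fun s hs => ⟨hm s ((hP s).2 (.inr hs.1)), hs.2⟩)]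
  congr 1
  ext s
  simp only [Set.mem_ofPred_eq, Set.mem_union, hP]
  tauto

/-- Adding `c` to each of the `m` elements and then adjoining a fixed multiset `t`. -/
lemma countSum_add_map {P Q : Multiset ℕ → Prop} {m : ℕ} (c : ℕ) (t : Multiset ℕ)
    (hm : ∀ s, Q s → s.card = m) (hP : ∀ s, P s ↔ ∃ v, Q v ∧ t + v.map (· + c) = s) (n : ℤ) :
    countSum P n = countSum Q (n - t.sum - c * m) := by
  have hsum (v : Multiset ℕ) (hv : Q v) :
      ((t + v.map (· + c)).sum : ℤ) = t.sum + (v.sum + c * m) := by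
    simp [Multiset.sum_map_add, hm v hv, mul_comm]
  have himage : {s : Multiset ℕ | P s ∧ (s.sum : ℤ) = n} =
      (fun v => t + v.map (· + c)) '' {s | Q s ∧ (s.sum : ℤ) = n - t.sum - c * m} := by
    ext s
    simp only [Set.mem_ofPred_eq, Set.mem_image, hP]
    constructor
    · rintro ⟨⟨v, hv, rfl⟩, hs⟩
      rw [hsum v hv] at hs
      exact ⟨v, ⟨hv, by omega⟩, rfl⟩
    · rintro ⟨v, ⟨hv, hs⟩, rfl⟩
      refine ⟨⟨v, hv, rfl⟩, ?_⟩
      rw [hsum v hv]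
      omega
  rw [countSum, countSum, himage, Set.ncard_image_of_injective]
  intro v w h
  exact Multiset.map_injective (add_left_injective c) (add_left_cancel h)

lemma exists_map_add_eq {u : Multiset ℕ} {c : ℕ} (h : ∀ x ∈ u, c ≤ x) :
    ∃ v : Multiset ℕ, v.map (· + c) = u := by
  refine ⟨u.map (· - c), ?_⟩
  rw [Multiset.map_map]
  conv_rhs => rw [← Multiset.map_id u]
  exact Multiset.map_congr rfl fun x hx => Nat.sub_add_cancel (h x hx)

lemma count_add_map_add (v : Multiset ℕ) (c x : ℕ) :
    (v.map (· + c)).count (x + c) = v.count x :=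
  Multiset.count_map_eq_count' (· + c) v (add_left_injective c) x

lemma card_partition_eq_countSum {n : ℕ} {P : n.Partition → Prop} {Q : Multiset ℕ → Prop}
    (hpos : ∀ s, Q s → ∀ x ∈ s, 0 < x) (h : ∀ p : n.Partition, P p ↔ Q p.parts) :
    Nat.card {p : n.Partition // P p} = countSum Q n := by
  rw [countSum, ← Nat.card_coe_set_eq]
  refine Nat.card_congr
    { toFun := fun p => ⟨p.1.parts, (h _).1 p.2, by rw [p.1.parts_sum]⟩
      invFun := fun s => ⟨⟨s.1, fun {x} hx => hpos _ s.2.1 x hx, by exact_mod_cast s.2.2⟩,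
        (h _).2 s.2.1⟩
      left_inv := fun p => rfl
      right_inv := fun s => rfl }

/-! ### Partitions with parts differing by at least two -/

/-- `m` elements, all at least `a`, at most `c` of them equal to `a`, and any two differing
by at least `2`. -/
def GapTwo (a c m : ℕ) (s : Multiset ℕ) : Prop :=
  s.card = m ∧ (∀ x ∈ s, a ≤ x) ∧ s.count a ≤ c ∧ ∀ x, s.count x + s.count (x + 1) ≤ 1

lemma gapTwo_zero_iff (a m : ℕ) (s : Multiset ℕ) :
    GapTwo a 0 m s ↔ ∃ v, GapTwo a 1 m v ∧ 0 + v.map (· + 1) = s := by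
  simp only [zero_add]
  constructor
  · rintro ⟨hc, ha, h0, hg⟩
    have hlt : ∀ x ∈ s, a + 1 ≤ x := fun x hx => by
      have := ha x hx
      have : x ≠ a := by
        rintro rfl
        exact absurd hx (Multiset.count_eq_zero.1 (by omega))
      omega
    obtain ⟨v, rfl⟩ := exists_map_add_eq (u := s) (c := 1) fun x hx => by
      have := hlt x hx
      omega
    refine ⟨v, ⟨by simpa using hc, fun x hx => ?_, ?_, fun x => ?_⟩, rfl⟩
    · have := hlt (x + 1) (Multiset.mem_map_of_mem _ hx)
      omega
    · have := hg (a + 1)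
      simp only [count_add_map_add] at this
      omega
    · simpa only [count_add_map_add] using hg (x + 1)
  · rintro ⟨v, ⟨hc, ha, h1, hg⟩, rfl⟩
    have hlt : ∀ x ∈ v.map (· + 1), a + 1 ≤ x := by
      simpa using ha
    refine ⟨by simpa using hc, fun x hx => by have := hlt x hx; omega, ?_, fun x => ?_⟩
    · rw [Multiset.count_eq_zero_of_notMem fun h => by have := hlt a h; omega]
    · rcases x with _ | x
      · rw [Multiset.count_eq_zero_of_notMem fun h => by have := hlt 0 h; omega]
        have := hg 0
        rw [count_add_map_add]
        omega
      · simpa only [count_add_map_add] using hg x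

lemma gapTwo_one_and_count_iff (a m : ℕ) (s : Multiset ℕ) :
    (GapTwo a 1 (m + 1) s ∧ s.count a = 1) ↔
      ∃ v, GapTwo a 1 m v ∧ {a} + v.map (· + 2) = s := by
  simp only [Multiset.singleton_add]
  constructor
  · rintro ⟨⟨hc, ha, -, hg⟩, h1⟩
    obtain ⟨u, rfl⟩ := Multiset.exists_cons_of_mem (Multiset.count_pos.1 (by omega : 0 < s.count a))
    have hu : a ∉ u := by
      rw [Multiset.count_cons_self] at h1
      exact Multiset.count_eq_zero.1 (by omega)
    have hu1 : a + 1 ∉ u := by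
      have := hg a
      rw [h1] at this
      intro h
      have := Multiset.count_pos.2 (Multiset.mem_cons_of_mem (b := a) h)
      omega
    have hlt : ∀ x ∈ u, a + 2 ≤ x := fun x hx => by
      have := ha x (Multiset.mem_cons_of_mem hx)
      have : x ≠ a := by rintro rfl; exact hu hx
      have : x ≠ a + 1 := by rintro rfl; exact hu1 hx
      omega
    obtain ⟨v, rfl⟩ := exists_map_add_eq (u := u) (c := 2) fun x hx => by
      have := hlt x hx
      omega
    have hgv : ∀ x, v.count x + v.count (x + 1) ≤ 1 := fun x => by
      refine le_trans (add_le_add ?_ ?_) (hg (x + 2))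
      · rw [← count_add_map_add v 2 x]
        exact Multiset.count_le_count_cons _ _ _
      · rw [← count_add_map_add v 2 (x + 1)]
        exact Multiset.count_le_count_cons _ _ _
    refine ⟨v, ⟨by simpa using hc, fun x hx => ?_, ?_, hgv⟩, rfl⟩
    · have := hlt (x + 2) (Multiset.mem_map_of_mem _ hx)
      omega
    · have := hgv a
      omega
  · rintro ⟨v, ⟨hc, ha, -, hg⟩, rfl⟩
    have hlt : ∀ x ∈ v.map (· + 2), a + 2 ≤ x := by
      simpa using ha
    have hcount : ∀ x < a + 2, (v.map (· + 2)).count x = 0 := fun x hx =>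
      Multiset.count_eq_zero_of_notMem fun h => by have := hlt x h; omega
    have h1 : (a ::ₘ v.map (· + 2)).count a = 1 := by
      rw [Multiset.count_cons_self, hcount a (by omega)]
    refine ⟨⟨by simpa using hc, ?_, h1.le, fun x => ?_⟩, h1⟩
    · intro x hx
      rcases Multiset.mem_cons.1 hx with rfl | hx
      · exact le_rfl
      · have := hlt x hx
        omega
    · by_cases hx : x < a + 1
      · simp only [Multiset.count_cons, hcount x (by omega), hcount (x + 1) (by omega)]
        split <;> split <;> omega
      · rw [Multiset.count_cons_of_ne (by omega), Multiset.count_cons_of_ne (by omega)]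
        by_cases hx' : x < a + 2
        · rw [hcount x hx']
          obtain rfl : x = a + 1 := by omega
          have := hg a
          rw [show a + 1 + 1 = a + 2 from rfl, count_add_map_add]
          omega
        · obtain ⟨y, rfl⟩ : ∃ y, x = y + 2 := ⟨x - 2, by omega⟩
          rw [show y + 2 + 1 = y + 1 + 2 by omega, count_add_map_add, count_add_map_add]
          exact hg y

lemma countSum_gapTwo_zero (a m : ℕ) (n : ℤ) :
    countSum (GapTwo a 0 m) n = countSum (GapTwo a 1 m) (n - m) := by
  rw [countSum_add_map 1 0 (fun _ h => h.1) (gapTwo_zero_iff a m)]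
  congr 1
  simp

lemma countSum_gapTwo_one (a m : ℕ) (n : ℤ) :
    countSum (GapTwo a 1 (m + 1)) n =
      countSum (GapTwo a 0 (m + 1)) n + countSum (GapTwo a 1 m) (n - a - 2 * m) := by
  rw [countSum_add (R := fun s => GapTwo a 1 (m + 1) s ∧ s.count a = 1) (fun _ h => h.1)
    (Q := GapTwo a 0 (m + 1)) _ _ n,
    countSum_add_map 2 {a} (fun _ h => h.1) (gapTwo_one_and_count_iff a m)]
  · simp
  · intro s
    simp only [GapTwo]
    grind
  · rintro s ⟨-, -, h0, -⟩ ⟨-, h1⟩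
    omega

lemma countSum_gapTwo_zero_succ (a m : ℕ) (n : ℤ) :
    countSum (GapTwo a 0 (m + 1)) n = countSum (GapTwo a 1 (m + 1)) (n - 2 * (m + 1 : ℕ)) +
      countSum (GapTwo a 1 m) (n - a - 3 * m - 1) := by
  rw [countSum_gapTwo_zero, countSum_gapTwo_one, countSum_gapTwo_zero]
  congr 2 <;> push_cast <;> ring

lemma countSum_gapTwo_one_succ (a m : ℕ) (n : ℤ) :
    countSum (GapTwo a 1 (m + 1)) n = countSum (GapTwo a 1 (m + 1)) (n - (m + 1)) +
      countSum (GapTwo a 0 m) (n - a - m) := by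
  rw [countSum_gapTwo_one a m n, countSum_gapTwo_zero, countSum_gapTwo_zero, Nat.cast_succ]
  congr 2
  ring

/-! ### Partitions with a gap condition on odd parts and large even parts -/

/-- `m` elements, with odd ones at least `2k+1`, at most `c` equal to `2k+1`, even ones at least
`2(t+k)`, and at most two odd elements in any window `{x, x+2}`. -/
def OddGap (k c m t : ℕ) (s : Multiset ℕ) : Prop :=
  s.card = m ∧ (∀ x ∈ s, Odd x → 2 * k + 1 ≤ x) ∧ s.count (2 * k + 1) ≤ c ∧
    (∀ x ∈ s, Even x → 2 * (t + k) ≤ x) ∧ ∀ x, Odd x → s.count x + s.count (x + 2) ≤ 2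

lemma oddGap_and_count_iff {k j c m t : ℕ} (hjc : j + c = 2) (s : Multiset ℕ) :
    (OddGap k j (m + j) (t + 1) s ∧ s.count (2 * k + 1) = j) ↔
      ∃ v, OddGap k c m t v ∧ Multiset.replicate j (2 * k + 1) + v.map (· + 2) = s := by
  constructor
  · rintro ⟨⟨hc, ho, -, he, hg⟩, hj⟩
    obtain ⟨u, rfl⟩ := Multiset.le_iff_exists_add.1 (Multiset.le_count_iff_replicate_le.1 hj.ge)
    have hu : 2 * k + 1 ∉ u := by
      rw [Multiset.count_add, Multiset.count_replicate_self] at hj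
      exact Multiset.count_eq_zero.1 (by omega)
    have ho' : ∀ x ∈ u, Odd x → 2 * k + 3 ≤ x := fun x hx hxo => by
      have := ho x (Multiset.mem_add.2 (.inr hx)) hxo
      have : x ≠ 2 * k + 1 := by rintro rfl; exact hu hx
      obtain ⟨y, rfl⟩ := hxo
      omega
    have he' : ∀ x ∈ u, Even x → 2 * (t + 1 + k) ≤ x := fun x hx =>
      he x (Multiset.mem_add.2 (.inr hx))
    obtain ⟨v, rfl⟩ := exists_map_add_eq (u := u) (c := 2) fun x hx => by
      rcases Nat.even_or_odd x with h | h
      · have := he' x hx h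
        omega
      · have := ho' x hx h
        omega
    have hle : ∀ x, v.count x ≤
        (Multiset.replicate j (2 * k + 1) + v.map (· + 2)).count (x + 2) := fun x => by
      rw [Multiset.count_add, count_add_map_add]
      omega
    refine ⟨v, ⟨by simpa [add_comm] using hc, fun x hx hxo => ?_, ?_, fun x hx hxe => ?_,
      fun x hx => ?_⟩, rfl⟩
    · have := ho' (x + 2) (Multiset.mem_map_of_mem _ hx) (by grind)
      omega
    · have h1 := hg (2 * k + 1) (by simp)
      have h2 := hle (2 * k + 1)
      omega
    · have := he' (x + 2) (Multiset.mem_map_of_mem _ hx) (by grind)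
      omega
    · exact (add_le_add (hle x) (hle (x + 2))).trans (hg (x + 2) (by grind))
  · rintro ⟨v, ⟨hc, ho, hk, he, hg⟩, rfl⟩
    have ho' : ∀ x ∈ v.map (· + 2), Odd x → 2 * k + 3 ≤ x := by
      simp only [Multiset.mem_map]
      rintro _ ⟨x, hx, rfl⟩ hxo
      have := ho x hx (by grind)
      omega
    have hcount : ∀ x, Odd x → x < 2 * k + 3 → (v.map (· + 2)).count x = 0 := fun x hxo hx =>
      Multiset.count_eq_zero_of_notMem fun h => by have := ho' x h hxo; omega
    have hj : (Multiset.replicate j (2 * k + 1) + v.map (· + 2)).count (2 * k + 1) = j := by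
      rw [Multiset.count_add, Multiset.count_replicate_self, hcount _ (by simp) (by omega),
        add_zero]
    refine ⟨⟨by simp [hc, add_comm], fun x hx hxo => ?_, hj.le, fun x hx hxe => ?_,
      fun x hxo => ?_⟩, hj⟩
    · rcases Multiset.mem_add.1 hx with hx | hx
      · exact (Multiset.eq_of_mem_replicate hx).ge
      · have := ho' x hx hxo
        omega
    · rcases Multiset.mem_add.1 hx with hx | hx
      · rw [Multiset.eq_of_mem_replicate hx] at hxe
        grind
      · obtain ⟨y, hy, rfl⟩ := Multiset.mem_map.1 hx
        have := he y hy (by grind)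
        omega
    · simp only [Multiset.count_add, Multiset.count_replicate]
      by_cases h1 : x < 2 * k + 1
      · rw [hcount x hxo (by omega), hcount (x + 2) (by grind) (by omega)]
        split <;> split <;> omega
      · rw [count_add_map_add]
        by_cases h2 : x = 2 * k + 1
        · subst h2
          rw [hcount _ hxo (by omega)]
          simp only [if_true]
          split <;> omega
        · obtain ⟨y, rfl⟩ : ∃ y, x = y + 2 := ⟨x - 2, by grind⟩
          rw [count_add_map_add, if_neg (by omega), if_neg (by omega)]
          have := hg y (by grind)
          omega

lemma countSum_oddGap_count {k j c : ℕ} (hjc : j + c = 2) (m t : ℕ) (n : ℤ) :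
    countSum (fun s => OddGap k j (m + j) (t + 1) s ∧ s.count (2 * k + 1) = j) n =
      countSum (OddGap k c m t) (n - j * (2 * k + 1) - 2 * m) := by
  rw [countSum_add_map 2 _ (fun _ h => h.1) (oddGap_and_count_iff hjc)]
  simp

lemma countSum_oddGap_succ (k c m t : ℕ) (n : ℤ) :
    countSum (OddGap k (c + 1) m t) n = countSum (OddGap k c m t) n +
      countSum (fun s => OddGap k (c + 1) m t s ∧ s.count (2 * k + 1) = c + 1) n := by
  refine countSum_add (fun _ h => h.1) (fun s => ?_) ?_ n
  · simp only [OddGap]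
    grind
  · rintro s ⟨-, -, h0, -⟩ ⟨-, h1⟩
    omega

lemma countSum_oddGap_zero (k m t : ℕ) (n : ℤ) :
    countSum (OddGap k 0 m (t + 1)) n = countSum (OddGap k 2 m t) (n - 2 * m) := by
  have h := countSum_oddGap_count (k := k) (zero_add 2) m t n
  simp only [Nat.cast_zero, zero_mul, sub_zero] at h
  rw [← h]
  exact countSum_congr (fun s => ⟨fun h => ⟨h, Nat.le_zero.1 h.2.2.1⟩, fun h => h.1⟩) n

lemma countSum_oddGap_one (k m t : ℕ) (n : ℤ) :
    countSum (OddGap k 1 (m + 1) (t + 1)) n = countSum (OddGap k 0 (m + 1) (t + 1)) n +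
      countSum (OddGap k 1 m t) (n - (2 * k + 1) - 2 * m) := by
  have h := countSum_oddGap_count (k := k) (one_add_one_eq_two) m t n
  simp only [Nat.cast_one, one_mul] at h
  rw [← h]
  exact countSum_oddGap_succ k 0 (m + 1) (t + 1) n

lemma countSum_oddGap_two (k m t : ℕ) (n : ℤ) :
    countSum (OddGap k 2 (m + 2) (t + 1)) n = countSum (OddGap k 1 (m + 2) (t + 1)) n +
      countSum (OddGap k 0 m t) (n - 2 * (2 * k + 1) - 2 * m) := by
  have h := countSum_oddGap_count (k := k) (add_zero 2) m t n
  simp only [Nat.cast_ofNat] at h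
  rw [countSum_oddGap_succ, ← h]

lemma countSum_oddGap_two_of_card_one (k t : ℕ) (n : ℤ) :
    countSum (OddGap k 2 1 t) n = countSum (OddGap k 1 1 t) n := by
  refine countSum_congr (fun s => ?_) n
  have : s.card = 1 → s.count (2 * k + 1) ≤ 1 := fun h => h ▸ Multiset.count_le_card _ _
  simp only [OddGap]
  grind

lemma oddGap_and_mem_iff (k c m t : ℕ) (s : Multiset ℕ) :
    (OddGap k c (m + 1) t s ∧ 2 * (t + k) ∈ s) ↔
      ∃ v, OddGap k c m t v ∧ {2 * (t + k)} + v.map (· + 0) = s := by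
  simp only [add_zero, Multiset.map_id', Multiset.singleton_add]
  have hcount (v : Multiset ℕ) (x : ℕ) (hx : Odd x) :
      (2 * (t + k) ::ₘ v).count x = v.count x :=
    Multiset.count_cons_of_ne (by grind) v
  have iff_cons (v : Multiset ℕ) :
      OddGap k c (m + 1) t (2 * (t + k) ::ₘ v) ↔ OddGap k c m t v := by
    have hgap : (∀ x, Odd x →
        (2 * (t + k) ::ₘ v).count x + (2 * (t + k) ::ₘ v).count (x + 2) ≤ 2) ↔
        ∀ x, Odd x → v.count x + v.count (x + 2) ≤ 2 :=
      forall₂_congr fun x hx => by rw [hcount v x hx, hcount v (x + 2) (by grind)]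
    have h1 : ¬ Odd (2 * (t + k)) := by simp
    simp [OddGap, hcount v (2 * k + 1) (by simp), hgap, h1, -Nat.not_odd_iff_even]
  constructor
  · rintro ⟨h, hmem⟩
    obtain ⟨v, rfl⟩ := Multiset.exists_cons_of_mem hmem
    exact ⟨v, (iff_cons v).1 h, rfl⟩
  · rintro ⟨v, hv, rfl⟩
    exact ⟨(iff_cons v).2 hv, Multiset.mem_cons_self _ _⟩

/-- Raising the lower bound on even parts. -/
lemma countSum_oddGap_even (k c m t : ℕ) (n : ℤ) :
    countSum (OddGap k c (m + 1) t) n = countSum (OddGap k c (m + 1) (t + 1)) n +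
      countSum (OddGap k c m t) (n - 2 * (t + k)) := by
  rw [countSum_add (Q := OddGap k c (m + 1) (t + 1))
    (R := fun s => OddGap k c (m + 1) t s ∧ 2 * (t + k) ∈ s) (fun _ h => h.1) _ _ n,
    countSum_add_map 0 {2 * (t + k)} (fun _ h => h.1) (oddGap_and_mem_iff k c m t)]
  · simp
  · intro s
    constructor
    · intro h
      by_cases hmem : 2 * (t + k) ∈ s
      · exact .inr ⟨h, hmem⟩
      · refine .inl ⟨h.1, h.2.1, h.2.2.1, fun x hx hxe => ?_, h.2.2.2.2⟩
        have := h.2.2.2.1 x hx hxe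
        have : x ≠ 2 * (t + k) := by rintro rfl; exact hmem hx
        grind
    · rintro (h | h)
      · exact ⟨h.1, h.2.1, h.2.2.1, fun x hx hxe => by have := h.2.2.2.1 x hx hxe; omega,
          h.2.2.2.2⟩
      · exact h.1
  · rintro s h ⟨-, hmem⟩
    have := h.2.2.2.1 _ hmem (by simp)
    omega

/-! ### Comparing the two families -/

lemma countSum_oddGap_eq_gapTwo (k m : ℕ) (n : ℤ) :
    countSum (OddGap k 0 m m) n = countSum (GapTwo (2 * k + 1) 0 m) n ∧
      countSum (OddGap k 1 m m) n = countSum (GapTwo (2 * k + 1) 1 m) n := by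
  induction m using Nat.strong_induction_on generalizing n with
  | _ m ihm =>
  obtain ⟨N, hN⟩ : ∃ N : ℕ, n < N := ⟨n.toNat + 1, by omega⟩
  induction N generalizing n with
  | zero =>
    simp only [Nat.cast_zero] at hN
    simp only [countSum_of_neg _ hN, and_self]
  | succ N ihN =>
    rcases m with _ | m
    · have h (c : ℕ) (s : Multiset ℕ) : OddGap k c 0 0 s ↔ GapTwo (2 * k + 1) c 0 s := by
        simp only [OddGap, GapTwo]
        constructor <;>
        · intro h
          obtain rfl := Multiset.card_eq_zero.1 h.1
          simp
      exact ⟨countSum_congr (h 0) n, countSum_congr (h 1) n⟩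
    have h0 : countSum (OddGap k 0 (m + 1) (m + 1)) n =
        countSum (GapTwo (2 * k + 1) 0 (m + 1)) n := by
      have hshift := (ihN (n - 2 * (m + 1 : ℕ)) (by omega)).2
      rw [countSum_oddGap_zero, countSum_gapTwo_zero_succ, ← hshift]
      rcases m with _ | m
      · rw [countSum_oddGap_two_of_card_one, countSum_oddGap_even, (ihm 0 (by omega) _).2]
        congr 2
        push_cast
        ring
      · rw [countSum_oddGap_two, countSum_oddGap_even, (ihm (m + 1) (by omega) _).2,
          (ihm m (by omega) _).1, countSum_gapTwo_one_succ _ _ (_ - _ - 1), add_assoc]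
        congr 3 <;> push_cast <;> ring
    refine ⟨h0, ?_⟩
    rw [countSum_oddGap_one, countSum_gapTwo_one, h0, (ihm m (by omega) _).2]
    push_cast
    rfl

lemma p2k1_eq_countSum (k i m n : ℕ) : p2k1 k i m n = countSum (OddGap k (i - 1) m m) n := by
  refine card_partition_eq_countSum (fun s hs x hx => ?_) fun p => ?_
  · have hm : 0 < m := hs.1 ▸ Multiset.card_pos_iff_exists_mem.2 ⟨x, hx⟩
    rcases Nat.even_or_odd x with h | h
    · have := hs.2.2.2.1 x hx h
      omega
    · exact h.pos
  · rw [gapCond_oddParts_iff]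
    refine and_congr_right fun hm => ⟨?_, ?_⟩
    · rintro ⟨h1, h2⟩
      exact ⟨fun x hx _ => h1 x hx, h2⟩
    · rintro ⟨h1, h2⟩
      refine ⟨fun x hx => ?_, h2⟩
      have hm : 0 < m := hm ▸ Multiset.card_pos_iff_exists_mem.2 ⟨x, hx⟩
      rcases Nat.even_or_odd x with h | h
      · have := h2.2.1 x hx h
        omega
      · exact h1 x hx h

lemma b2k1_eq_countSum (k i m n : ℕ) :
    b2k1 k i m n = countSum (GapTwo (2 * k + 1) (i - 1) m) n := by
  refine card_partition_eq_countSum (fun s hs x hx => ?_) fun p => ?_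
  · have := hs.2.1 x hx
    omega
  · rw [gapCond_sortedParts_iff]
    rfl

/-- For all `k ≥ 1`, `m, n ≥ 0` and `i = 1` or `2`,
`p^{2k+1}_{2,i}(m,n) = b^{2k+1}_{2,i}(m,n)`. -/
theorem p2k1_eq_b2k1 (k m n i : ℕ) (hk : 1 ≤ k) (hi : i = 1 ∨ i = 2) :
    p2k1 k i m n = b2k1 k i m n := by
  rw [p2k1_eq_countSum, b2k1_eq_countSum]
  rcases hi with rfl | rfl
  · exact (countSum_oddGap_eq_gapTwo k m n).1
  · exact (countSum_oddGap_eq_gapTwo k m n).2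
end

section
/- For all integers k ≥ 1, m ≥ 1, and n ≥ 2m + 2k - 2, p^{2k}_{2,2}(m,n) - p^{2k}_{2,1}(m,n) = p^{2k}_{2,2}(m-1, n - 2m - 2k + 2), where p^{2k}_{2,i}(m,n) counts partitions of n with exactly m parts, all parts at least 2k, at most i-1 parts equal to 2k, every odd part plus 1 at least 2(m+k), and even parts (in decreasing order) satisfying λ_{i_ℓ} - λ_{i_{ℓ+2}} ≥ 4. -/
/-- `p2k k i m n` = number of partitions of `n` with exactly `m` parts, all parts
at least `2k`, at most `i - 1` parts equal to `2k`, every odd part plus `1` at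
least `2(m+k)`, and even parts (in decreasing order) satisfying
`λ_{i_ℓ} - λ_{i_{ℓ+2}} ≥ 4`. -/
noncomputable def p2k (k i m n : ℕ) : ℕ :=
  Nat.card {p : n.Partition //
    Multiset.card p.parts = m ∧
    (∀ x ∈ p.parts, 2 * k ≤ x) ∧
    Multiset.count (2 * k) p.parts ≤ i - 1 ∧
    (∀ x ∈ p.parts, ¬ Even x → 2 * (m + k) ≤ x + 1) ∧
    GapCond p.evenParts 2 4}

/-- The conditions counted by `p2k`, as a predicate on multisets of parts. -/
def IsAdmissible (k i m : ℕ) (s : Multiset ℕ) : Prop :=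
  Multiset.card s = m ∧
    (∀ x ∈ s, 2 * k ≤ x) ∧
    Multiset.count (2 * k) s ≤ i - 1 ∧
    (∀ x ∈ s, ¬ Even x → 2 * (m + k) ≤ x + 1) ∧
    GapCond ((s.filter (fun x => Even x)).sort (· ≤ ·)) 2 4

theorem p2k_eq_card (k i m n : ℕ) :
    p2k k i m n = Nat.card {p : n.Partition // IsAdmissible k i m p.parts} := rfl

theorem gapCond_cons_two {a b c g : ℕ} {L : List ℕ} :
    GapCond (a :: b :: c :: L) 2 g ↔ g ≤ c - a ∧ GapCond (b :: c :: L) 2 g := by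
  constructor
  · intro h
    refine ⟨by simpa using h 0 (by simp), fun ℓ hℓ => ?_⟩
    simpa using h (ℓ + 1) (by simpa using hℓ)
  · rintro ⟨h0, h⟩ (_ | ℓ) hℓ
    · simpa using h0
    · simpa using h ℓ (by simpa using hℓ)

theorem gapCond_map_add (L : List ℕ) (d g c : ℕ) :
    GapCond (L.map (· + c)) d g ↔ GapCond L d g := by
  unfold GapCond
  rw [List.length_map]
  refine forall₂_congr fun ℓ hℓ => ?_
  have h : ℓ < L.length := by omega
  simp [hℓ, h, Nat.add_sub_add_right]

/-- Prepending a smallest even part `a` and shifting the others by `2` turns the gap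
condition into the gap condition together with a bound on the multiplicity of `a`. -/
theorem gapCond_cons_map_add_two {a : ℕ} (ha : Even a) {L : List ℕ}
    (hL : L.Pairwise (· ≤ ·)) (hle : ∀ x ∈ L, a ≤ x) (heven : ∀ x ∈ L, Even x) :
    GapCond (a :: L.map (· + 2)) 2 4 ↔ L.count a ≤ 1 ∧ GapCond L 2 4 := by
  rw [← gapCond_map_add L 2 4 2]
  match L, hL, hle, heven with
  | [], _, _, _ => simp [GapCond]
  | [b], _, _, _ =>
    have : List.count a [b] ≤ 1 := List.count_le_length
    simp [GapCond, this]
  | b :: c :: L, hL, hle, heven =>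
    simp only [List.map_cons, gapCond_cons_two]
    refine and_congr_left' ?_
    obtain ⟨u, hu⟩ := ha
    obtain ⟨v, hv⟩ := heven c (by simp)
    have hac := hle c (by simp)
    have hab := hle b (by simp)
    simp only [List.pairwise_cons] at hL
    have hbc := hL.1 c (by simp)
    constructor
    · intro h
      have : List.count a (c :: L) = 0 := by
        refine List.count_eq_zero.2 fun hmem => ?_
        rcases List.mem_cons.1 hmem with h' | h'
        · omega
        · have := hL.2.1 a h'
          omega
      rw [List.count_cons, this]
      split <;> omega
    · intro h
      by_contra hlt
      obtain rfl : c = a := by omega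
      obtain rfl : b = c := by omega
      simp at h

theorem sort_cons_map_add {a c : ℕ} {s : Multiset ℕ} (h : ∀ x ∈ s, a ≤ x) :
    (a ::ₘ s.map (· + c)).sort (· ≤ ·) = a :: (s.sort (· ≤ ·)).map (· + c) := by
  rw [Multiset.sort_cons, Multiset.map_sort (· + c) s (· ≤ ·) (· ≤ ·)]
  · intro x _ y _
    simp
  · intro x hx
    obtain ⟨y, hy, rfl⟩ := Multiset.mem_map.1 hx
    exact (h y hy).trans (Nat.le_add_right y c)

theorem filter_even_cons_map_add_two (k : ℕ) (s : Multiset ℕ) :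
    (2 * k ::ₘ s.map (· + 2)).filter (fun x => Even x) =
      2 * k ::ₘ (s.filter (fun x => Even x)).map (· + 2) := by
  rw [Multiset.filter_cons_of_pos _ (even_two_mul k), Multiset.filter_map]
  congr 2
  exact Multiset.filter_congr fun x _ => by simp [Nat.even_add]

theorem isAdmissible_cons_map_add_two (k m : ℕ) (s : Multiset ℕ) :
    (IsAdmissible k 2 (m + 1) (2 * k ::ₘ s.map (· + 2)) ∧
      Multiset.count (2 * k) (2 * k ::ₘ s.map (· + 2)) = 1) ↔ IsAdmissible k 2 m s := by
  have key (h : ∀ x ∈ s, 2 * k ≤ x) :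
      GapCond (((2 * k ::ₘ s.map (· + 2)).filter (fun x => Even x)).sort (· ≤ ·)) 2 4 ↔
        Multiset.count (2 * k) s ≤ 1 ∧
          GapCond ((s.filter (fun x => Even x)).sort (· ≤ ·)) 2 4 := by
    have h' : ∀ x ∈ s.filter (fun x => Even x), 2 * k ≤ x := fun x hx =>
      h x (Multiset.mem_of_mem_filter hx)
    rw [filter_even_cons_map_add_two, sort_cons_map_add h',
      gapCond_cons_map_add_two (even_two_mul k) (Multiset.pairwise_sort _ _)
        (fun x hx => h' x (by simpa using hx)) (fun x hx => by simp_all),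
      ← Multiset.coe_count, Multiset.sort_eq, Multiset.count_filter_of_pos (even_two_mul k)]
  constructor
  · rintro ⟨⟨hcard, hle, -, hodd, hgap⟩, hcount⟩
    have hcard' : Multiset.card s = m := by simpa using hcard
    have hne : ∀ x ∈ s, x + 2 ≠ 2 * k := by
      simpa [Multiset.count_cons_self, Multiset.count_eq_zero] using hcount
    have hodd' : ∀ x ∈ s, ¬ Even x → 2 * (m + k) ≤ x + 1 := fun x hx hx' => by
      have := hodd (x + 2) (Multiset.mem_cons_of_mem (Multiset.mem_map_of_mem _ hx))
        (by simpa [Nat.even_add] using hx')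
      omega
    have hle' : ∀ x ∈ s, 2 * k ≤ x := fun x hx => by
      have h1 := hle (x + 2) (Multiset.mem_cons_of_mem (Multiset.mem_map_of_mem _ hx))
      have h2 := hne x hx
      have h3 : 0 < Multiset.card s := Multiset.card_pos_iff_exists_mem.2 ⟨x, hx⟩
      by_cases hx' : Even x
      · obtain ⟨y, rfl⟩ := hx'
        omega
      · have := hodd' x hx hx'
        omega
    exact ⟨hcard', hle', ((key hle').1 hgap).1, hodd', ((key hle').1 hgap).2⟩
  · rintro ⟨hcard, hle, hcount, hodd, hgap⟩
    have hcount' : Multiset.count (2 * k) (2 * k ::ₘ s.map (· + 2)) = 1 := by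
      have : 2 * k ∉ s.map (· + 2) := fun hmem => by
        obtain ⟨x, hx, hxk⟩ := Multiset.mem_map.1 hmem
        have := hle x hx
        omega
      rw [Multiset.count_cons_self, Multiset.count_eq_zero_of_notMem this]
    refine ⟨⟨by simp [hcard], ?_, hcount'.le, ?_, (key hle).2 ⟨hcount, hgap⟩⟩, hcount'⟩
    · intro x hx
      rcases Multiset.mem_cons.1 hx with rfl | hx
      · exact le_rfl
      · obtain ⟨y, hy, rfl⟩ := Multiset.mem_map.1 hx
        exact (hle y hy).trans (Nat.le_add_right y 2)
    · intro x hx hx'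
      rcases Multiset.mem_cons.1 hx with rfl | hx
      · exact absurd (even_two_mul k) hx'
      · obtain ⟨y, hy, rfl⟩ := Multiset.mem_map.1 hx
        have := hodd y hy (by simpa [Nat.even_add] using hx')
        omega

theorem p2k_two_eq_add (k m n : ℕ) :
    p2k k 2 m n = p2k k 1 m n + Nat.card {p : n.Partition //
      IsAdmissible k 2 m p.parts ∧ Multiset.count (2 * k) p.parts = 1} := by
  classical
  simp only [p2k_eq_card, Nat.card_eq_fintype_card]
  rw [← Fintype.card_subtype_or_disjoint]
  · refine Fintype.card_congr (Equiv.subtypeEquivRight fun p => ?_)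
    unfold IsAdmissible
    grind
  · rw [Pi.disjoint_iff]
    intro p
    rw [Prop.disjoint_iff]
    unfold IsAdmissible
    grind

theorem sum_cons_map_add_two (k : ℕ) (s : Multiset ℕ) :
    (2 * k ::ₘ s.map (· + 2)).sum = s.sum + 2 * Multiset.card s + 2 * k := by
  simp [Multiset.sum_map_add]
  ring

theorem card_isAdmissible_count_eq_one {k m n n' : ℕ} (hk : 1 ≤ k)
    (hn : n = n' + 2 * m + 2 * k) :
    Nat.card {p : n.Partition //
      IsAdmissible k 2 (m + 1) p.parts ∧ Multiset.count (2 * k) p.parts = 1} =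
      p2k k 2 m n' := by
  rw [p2k_eq_card]
  symm
  refine Nat.card_eq_of_bijective (fun q => ⟨⟨2 * k ::ₘ q.1.parts.map (· + 2), ?_, ?_⟩,
    (isAdmissible_cons_map_add_two k m q.1.parts).2 q.2⟩) ⟨?_, ?_⟩
  · intro x hx
    rcases Multiset.mem_cons.1 hx with rfl | hx
    · omega
    · obtain ⟨y, -, rfl⟩ := Multiset.mem_map.1 hx
      omega
  · rw [sum_cons_map_add_two, q.1.parts_sum, q.2.1, hn]
  · rintro ⟨q, hq⟩ ⟨q', hq'⟩ h
    simp only [Subtype.mk.injEq, Nat.Partition.mk.injEq, Multiset.cons_inj_right] at h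
    exact Subtype.ext (Nat.Partition.ext (Multiset.map_injective (add_left_injective 2) h))
  · rintro ⟨p, hp, hcount⟩
    have hmem : 2 * k ∈ p.parts := Multiset.count_pos.1 (by omega)
    have hparts : 2 * k ::ₘ ((p.parts.erase (2 * k)).map (· - 2)).map (· + 2) = p.parts := by
      conv_rhs => rw [← Multiset.cons_erase hmem]
      rw [Multiset.map_map]
      congr 1
      refine (Multiset.map_congr rfl fun x hx => ?_).trans (Multiset.map_id _)
      have := hp.2.1 x (Multiset.mem_of_mem_erase hx)
      simp only [Function.comp_apply, id_eq]
      omega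
    generalize (p.parts.erase (2 * k)).map (· - 2) = s at hparts
    have hs : IsAdmissible k 2 m s :=
      (isAdmissible_cons_map_add_two k m s).1 (hparts ▸ ⟨hp, hcount⟩)
    refine ⟨⟨⟨s, fun {x} hx => ?_, ?_⟩, hs⟩, Subtype.ext (Nat.Partition.ext hparts)⟩
    · have := hs.2.1 x hx
      omega
    · have h := sum_cons_map_add_two k s
      rw [hparts, p.parts_sum, hs.1] at h
      omega

/-- For `k ≥ 1`, `m ≥ 1` and `n ≥ 2m + 2k - 2`,
`p^{2k}_{2,2}(m,n) - p^{2k}_{2,1}(m,n) = p^{2k}_{2,2}(m-1, n - 2m - 2k + 2)`. -/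
theorem p2k_recursion_diff (k m n : ℕ) (hk : 1 ≤ k) (hm : 1 ≤ m)
    (hn : 2 * m + 2 * k - 2 ≤ n) :
    p2k k 2 m n - p2k k 1 m n = p2k k 2 (m - 1) (n + 2 - 2 * m - 2 * k) := by
  obtain ⟨m, rfl⟩ := Nat.exists_eq_add_of_le' hm
  rw [p2k_two_eq_add, Nat.add_sub_cancel_left, Nat.add_sub_cancel]
  exact card_isAdmissible_count_eq_one hk (by omega)
end
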